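/- If a metric space M contains an isometric copy of a line segment [0, δ] for some δ > 0, then the Lipschitz-free space F(M) contains a subspace isomorphic to L_1([0,1]); consequently F(M) has no unconditional Schauder basis. -/

import Mathlib

open scoped NNReal

/-- An unconditional Schauder basis of a Banach space: a biorthogonal system
`(e, coef)` such that every vector is the unconditional sum (in the sense of `HasSum`)
of its basis expansion. -/
def IsUnconditionalSchauderBasis (F : Type*) [NormedAddCommGroup F] [NormedSpace ℝ F]
    (e : ℕ → F) (coef : ℕ → F →L[ℝ] ℝ) : Prop :=
  (∀ i j, coef i (e j) = if i = j then 1 else 0) ∧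
    ∀ y : F, HasSum (fun i => coef i y • e i) y

section

open MeasureTheory Set

/-- Measurable subsets of the unit interval can be halved. -/
theorem exists_half_measure_unitInterval (A : Set (Icc (0 : ℝ) 1)) (hA : MeasurableSet A) :
    ∃ B ⊆ A, MeasurableSet B ∧
      (volume : Measure (Icc (0 : ℝ) 1)).real B =
        (volume : Measure (Icc (0 : ℝ) 1)).real A / 2 := by
  set ν : Measure (Icc (0 : ℝ) 1) := volume
  have hmeas (t : ℝ) : MeasurableSet {x : Icc (0 : ℝ) 1 | (x : ℝ) ≤ t} :=
    measurableSet_le measurable_subtype_coe measurable_const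
  let f (t : ℝ) : ℝ := ν.real (A ∩ {x | (x : ℝ) ≤ t})
  have hf : LipschitzWith 1 f := by
    refine LipschitzWith.of_le_add_mul 1 fun s t => ?_
    have h1 : A ∩ {x | (x : ℝ) ≤ s} ⊆
        (A ∩ {x | (x : ℝ) ≤ t}) ∪ (Subtype.val ⁻¹' Ioc t s : Set (Icc (0 : ℝ) 1)) := by
      rintro x ⟨hx, hxs⟩
      rcases le_or_gt (x : ℝ) t with h | h
      · exact Or.inl ⟨hx, h⟩
      · exact Or.inr ⟨h, hxs⟩
    have h2 : ν.real (Subtype.val ⁻¹' Ioc t s : Set (Icc (0 : ℝ) 1)) ≤ dist s t := by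
      have : ν (Subtype.val ⁻¹' Ioc t s : Set (Icc (0 : ℝ) 1)) ≤ volume (Ioc t s) := by
        rw [← volume_image_subtype_coe measurableSet_Icc]
        exact measure_mono (image_preimage_subset _ _)
      rw [Real.volume_Ioc] at this
      refine ENNReal.toReal_le_of_le_ofReal dist_nonneg (this.trans ?_)
      exact ENNReal.ofReal_le_ofReal (Real.dist_eq s t ▸ le_abs_self _)
    refine (measureReal_mono h1).trans ((measureReal_union_le _ _).trans ?_)
    rw [NNReal.coe_one, one_mul]
    gcongr
  have h0 : f (-1) = 0 := by
    have : A ∩ {x | (x : ℝ) ≤ -1} = ∅ := by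
      ext x
      have := x.2.1
      simp only [mem_inter_iff, mem_ofPred_eq, mem_empty_iff_false, iff_false, not_and, not_le]
      intro _
      linarith
    simp [f, this]
  have h1 : f 1 = ν.real A := by
    have : A ∩ {x | (x : ℝ) ≤ 1} = A := inter_eq_left.2 fun x _ => x.2.2
    simp [f, this]
  obtain ⟨t, -, ht⟩ := intermediate_value_Icc (by norm_num : (-1 : ℝ) ≤ 1)
    hf.continuous.continuousOn (show ν.real A / 2 ∈ Icc (f (-1)) (f 1) by
      rw [h0, h1]
      have : 0 ≤ ν.real A := measureReal_nonneg
      constructor <;> linarith)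
  exact ⟨_, inter_subset_left, hA.inter (hmeas t), ht⟩

/-- A curve in a Banach space whose increments are dominated by a finite measure is the
distribution function of a vector measure. -/
theorem exists_vectorMeasure_Ioc_eq_sub {F : Type*} [NormedAddCommGroup F] [CompleteSpace F]
    (D : ℝ → F) (μ : Measure ℝ) [IsFiniteMeasure μ]
    (hD : ∀ u v, u ≤ v → ‖D v - D u‖ₑ ≤ μ (Ioc u v)) :
    ∃ m : VectorMeasure ℝ F, (∀ u v, u ≤ v → m (Ioc u v) = D v - D u) ∧ ∀ s, ‖m s‖ₑ ≤ μ s := by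
  obtain ⟨m, hm, hm'⟩ :=
    VectorMeasure.exists_extension_of_isSetSemiring_of_le_measure_of_generateFrom (μ := μ)
      (m := AddContent.onIoc D) IsSetSemiring.Ioc
      (by rintro _ ⟨u, v, huv, rfl⟩; rw [AddContent.onIoc_apply huv]; exact hD u v huv)
      (by
        rw [BorelSpace.measurable_eq (α := ℝ), borel_eq_generateFrom_Ioc_le]
        simp only [eq_comm])
  exact ⟨m, fun u v huv => by rw [hm _ ⟨u, v, huv, rfl⟩, AddContent.onIoc_apply huv], hm'⟩

/-- A real vector measure on the line which vanishes outside `(a, b]` is determined by its values on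
half-open intervals. -/
theorem vectorMeasure_ext_of_Ioc {m₁ m₂ : VectorMeasure ℝ ℝ} (a b : ℝ)
    (h : ∀ u v, u ≤ v → m₁ (Ioc u v) = m₂ (Ioc u v))
    (h₁ : m₁ (Ioc a b)ᶜ = 0) (h₂ : m₂ (Ioc a b)ᶜ = 0) (hab : a ≤ b) : m₁ = m₂ := by
  refine VectorMeasure.ext_of_generateFrom {S | ∃ u v : ℝ, u < v ∧ Ioc u v = S} ?_ ?_
    (isPiSystem_Ioc id id) ?_
  · rintro _ ⟨u, v, huv, rfl⟩
    exact h u v huv.le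
  · rw [BorelSpace.measurable_eq (α := ℝ), borel_eq_generateFrom_Ioc]
  · rw [← union_compl_self (Ioc a b),
      VectorMeasure.of_union disjoint_compl_right measurableSet_Ioc measurableSet_Ioc.compl,
      VectorMeasure.of_union disjoint_compl_right measurableSet_Ioc measurableSet_Ioc.compl,
      h₁, h₂, h a b hab]

/-- A curve `D` on the unit interval with `δ`-Lipschitz increments induces an operator on `L¹`. If
moreover every `1`-Lipschitz function is, up to the factor `δ` and a constant, the composition of
`D` with a functional of norm at most one, then this operator is bounded below by `δ`. -/
theorem exists_clm_L1_unitInterval_of_curve {F : Type*} [NormedAddCommGroup F] [NormedSpace ℝ F]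
    [CompleteSpace F] (D : ℝ → F) {δ : ℝ} (hδ : 0 < δ)
    (hD : ∀ u ∈ Icc (0 : ℝ) 1, ∀ v ∈ Icc (0 : ℝ) 1, ‖D v - D u‖ ≤ δ * |v - u|)
    (hdual : ∀ Φ : ℝ → ℝ, LipschitzWith 1 Φ →
      ∃ τ : F →L[ℝ] ℝ, ‖τ‖ ≤ 1 ∧ ∃ b, ∀ t ∈ Icc (0 : ℝ) 1, τ (D t) = δ * Φ t + b) :
    ∃ T : Lp ℝ 1 (volume : Measure (Icc (0 : ℝ) 1)) →L[ℝ] F, ∀ g, δ * ‖g‖ ≤ ‖T g‖ := by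
  let ν : Measure (Icc (0 : ℝ) 1) := volume
  let μ : Measure ℝ := ν.map Subtype.val
  have hμ (s : Set ℝ) (hs : MeasurableSet s) : μ s = volume (s ∩ Icc 0 1) := by
    rw [Measure.map_apply measurable_subtype_coe hs, ← volume_image_subtype_coe measurableSet_Icc,
      Subtype.image_preimage_coe, inter_comm]
  let p (t : ℝ) : ℝ := max 0 (min 1 t)
  have hp (t : ℝ) : p t ∈ Icc (0 : ℝ) 1 := ⟨le_max_left _ _, max_le zero_le_one (min_le_left _ _)⟩
  have hpmono : Monotone p := fun u v huv => max_le_max le_rfl (min_le_min le_rfl huv)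
  have hpμ (u v : ℝ) : ENNReal.ofReal (p v - p u) ≤ μ (Ioc u v) := by
    rw [hμ _ measurableSet_Ioc, ← Real.volume_Ioc]
    refine measure_mono fun x hx => ?_
    simp only [p, mem_Ioc, mem_inter_iff, mem_Icc] at hx ⊢
    grind
  have : IsFiniteMeasure (ENNReal.ofReal δ • μ) := μ.smul_finite ENNReal.ofReal_ne_top
  obtain ⟨m, hm, hmμ⟩ := exists_vectorMeasure_Ioc_eq_sub (fun t => D (p t)) (ENNReal.ofReal δ • μ)
    (fun u v huv => by
      rw [Measure.smul_apply, smul_eq_mul]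
      refine le_trans ?_ (mul_le_mul_right (hpμ u v) _)
      rw [← ENNReal.ofReal_mul hδ.le, ← ofReal_norm]
      refine ENNReal.ofReal_le_ofReal ((hD _ (hp u) _ (hp v)).trans_eq ?_)
      rw [abs_of_nonneg (sub_nonneg.2 (hpmono huv))])
  have himg (s : Set (Icc (0 : ℝ) 1)) (hs : MeasurableSet s) :
      MeasurableSet (Subtype.val '' s : Set ℝ) := measurableSet_Icc.subtype_image hs
  have hdom : DominatedFinMeasAdditive ν
      (fun s => ContinuousLinearMap.toSpanSingleton ℝ (m (Subtype.val '' s))) δ := by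
    refine ⟨fun s t hs ht _ _ hst => ?_, fun s hs _ => ?_⟩
    · simp only
      rw [image_union, VectorMeasure.of_union
        ((disjoint_image_iff Subtype.val_injective).2 hst) (himg s hs) (himg t ht)]
      ext
      simp
    · rw [ContinuousLinearMap.norm_toSpanSingleton, ← toReal_enorm, measureReal_def,
        ← ENNReal.toReal_ofReal hδ.le, ← ENNReal.toReal_mul]
      refine ENNReal.toReal_mono (by finiteness) ((hmμ _).trans_eq ?_)
      rw [Measure.smul_apply, smul_eq_mul, Measure.map_apply measurable_subtype_coe (himg s hs),
        preimage_image_eq _ Subtype.val_injective]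
  refine ⟨L1.setToL1 hdom, fun g => ?_⟩
  let P : Set (Icc (0 : ℝ) 1) := {x | 0 ≤ g x}
  have hP : MeasurableSet P :=
    measurableSet_le measurable_const (Lp.stronglyMeasurable g).measurable
  let μ₁ : Measure ℝ := (ν.restrict P).map Subtype.val
  let μ₂ : Measure ℝ := (ν.restrict Pᶜ).map Subtype.val
  have hμ₁₂ : μ₁ + μ₂ = μ := by
    rw [← Measure.map_add _ _ measurable_subtype_coe, Measure.restrict_add_restrict_compl hP]
  let Φ (t : ℝ) : ℝ := μ₁.real (Iic t) - μ₂.real (Iic t)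
  have hΦ (u v : ℝ) (huv : u ≤ v) : Φ v - Φ u = μ₁.real (Ioc u v) - μ₂.real (Ioc u v) := by
    simp only [Φ]
    rw [← Iic_union_Ioc_eq_Iic huv, measureReal_union (Iic_disjoint_Ioc le_rfl) measurableSet_Ioc,
      measureReal_union (Iic_disjoint_Ioc le_rfl) measurableSet_Ioc]
    ring
  have hΦμ (u v : ℝ) (huv : u ≤ v) : |Φ v - Φ u| ≤ μ.real (Ioc u v) := by
    rw [hΦ u v huv, ← hμ₁₂, measureReal_add_apply]
    have h₁ : 0 ≤ μ₁.real (Ioc u v) := measureReal_nonneg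
    have h₂ : 0 ≤ μ₂.real (Ioc u v) := measureReal_nonneg
    rw [abs_le]
    constructor <;> linarith
  have hΦ_lip : LipschitzWith 1 Φ := by
    have h (u v : ℝ) (huv : u ≤ v) : dist (Φ u) (Φ v) ≤ dist u v := by
      rw [dist_comm, Real.dist_eq, dist_comm, Real.dist_eq, abs_of_nonneg (sub_nonneg.2 huv)]
      refine (hΦμ u v huv).trans (ENNReal.toReal_le_of_le_ofReal (sub_nonneg.2 huv) ?_)
      rw [hμ _ measurableSet_Ioc, ← Real.volume_Ioc]
      exact measure_mono inter_subset_left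
    refine LipschitzWith.of_dist_le_mul fun u v => ?_
    rw [NNReal.coe_one, one_mul]
    rcases le_total u v with huv | huv
    · exact h u v huv
    · rw [dist_comm, dist_comm u]
      exact h v u huv
  have hΦp (t : ℝ) : Φ (p t) = Φ t := by
    rw [← sub_eq_zero, ← abs_eq_zero]
    rcases le_total t (p t) with ht | ht
    · refine le_antisymm ((hΦμ _ _ ht).trans_eq ?_) (abs_nonneg _)
      rw [measureReal_def, hμ _ measurableSet_Ioc,
        measure_mono_null _ (Real.volume_singleton (a := 0)), ENNReal.toReal_zero]
      intro x hx
      simp only [p, mem_Ioc, mem_inter_iff, mem_Icc, mem_singleton_iff] at hx ⊢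
      grind
    · rw [abs_sub_comm]
      refine le_antisymm ((hΦμ _ _ ht).trans_eq ?_) (abs_nonneg _)
      rw [measureReal_def, hμ _ measurableSet_Ioc,
        measure_mono_null _ (Real.volume_singleton (a := 0)), ENNReal.toReal_zero]
      intro x hx
      simp only [p, mem_Ioc, mem_inter_iff, mem_Icc, mem_singleton_iff] at hx ⊢
      grind
  obtain ⟨τ, hτ, b, hτb⟩ := hdual Φ hΦ_lip
  let m₁ : VectorMeasure ℝ ℝ := m.mapRange (τ : F →+ ℝ) τ.continuous
  let m₂ : VectorMeasure ℝ ℝ := δ • (μ₁.toSignedMeasure - μ₂.toSignedMeasure)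
  have hm₁ (s : Set ℝ) : m₁ s = τ (m s) := rfl
  have hm₂ (s : Set ℝ) (hs : MeasurableSet s) : m₂ s = δ * (μ₁.real s - μ₂.real s) := by
    simp [m₂, Measure.toSignedMeasure_apply_measurable hs]
  have hcompl : μ (Ioc (-1) 1)ᶜ = 0 := by
    rw [hμ _ measurableSet_Ioc.compl]
    convert measure_empty (μ := (volume : Measure ℝ))
    ext x
    simp only [mem_inter_iff, mem_compl_iff, mem_Ioc, mem_Icc, mem_empty_iff_false]
    grind
  have hmm : m₁ = m₂ := by
    refine vectorMeasure_ext_of_Ioc (-1) 1 (fun u v huv => ?_) ?_ ?_ (by norm_num)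
    · rw [hm₁, hm₂ _ measurableSet_Ioc, hm u v huv, map_sub, hτb _ (hp u), hτb _ (hp v), hΦp, hΦp,
        ← hΦ u v huv]
      ring
    · have : ‖m (Ioc (-1) 1)ᶜ‖ₑ ≤ 0 := (hmμ _).trans_eq (by simp [hcompl])
      rw [hm₁, enorm_eq_zero.1 (le_antisymm this zero_le), map_zero]
    · rw [← hμ₁₂, Measure.add_apply, add_eq_zero] at hcompl
      rw [hm₂ _ measurableSet_Ioc.compl, measureReal_def, measureReal_def, hcompl.1, hcompl.2]
      simp
  have hrep (f : Lp ℝ 1 ν) :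
      τ (L1.setToL1 hdom f) = δ * (∫ x in P, f x ∂ν - ∫ x in Pᶜ, f x ∂ν) := by
    induction f using Lp.induction ENNReal.one_ne_top with
    | indicatorConst c hs hμs =>
      rename_i s
      rw [Lp.simpleFunc.coe_indicatorConst, L1.setToL1_indicatorConstLp,
        ContinuousLinearMap.toSpanSingleton_apply, map_smul, ← hm₁, hmm, hm₂ _ (himg s hs),
        integral_congr_ae (ae_restrict_of_ae indicatorConstLp_coeFn),
        integral_congr_ae (ae_restrict_of_ae indicatorConstLp_coeFn),
        integral_indicator_const _ hs, integral_indicator_const _ hs,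
        map_measureReal_apply measurable_subtype_coe (himg s hs),
        map_measureReal_apply measurable_subtype_coe (himg s hs),
        preimage_image_eq _ Subtype.val_injective]
      simp only [smul_eq_mul]
      ring
    | add hf hg _ ihf ihg =>
      rw [map_add, map_add, ihf, ihg,
        integral_congr_ae (ae_restrict_of_ae (Lp.coeFn_add _ _)),
        integral_congr_ae (ae_restrict_of_ae (Lp.coeFn_add _ _))]
      simp only [Pi.add_apply]
      rw [integral_add (L1.integrable_coeFn _).integrableOn (L1.integrable_coeFn _).integrableOn,
        integral_add (L1.integrable_coeFn _).integrableOn (L1.integrable_coeFn _).integrableOn]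
      ring
    | isClosed =>
      exact isClosed_eq (τ.continuous.comp (L1.setToL1 hdom).continuous)
        (continuous_const.mul ((continuous_setIntegral P).sub (continuous_setIntegral Pᶜ)))
  have hval : τ (L1.setToL1 hdom g) = δ * ‖g‖ := by
    rw [hrep, L1.norm_eq_integral_norm, ← integral_add_compl hP (L1.integrable_coeFn g).norm,
      setIntegral_congr_fun hP (g := fun x => ‖g x‖) fun x hx => (Real.norm_of_nonneg hx).symm,
      setIntegral_congr_fun hP.compl (g := fun x => -‖g x‖) fun x hx => ?_, integral_neg,
      sub_neg_eq_add]
    simp only [Real.norm_of_nonpos (le_of_not_ge hx), neg_neg]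
  rw [← hval]
  exact (le_abs_self _).trans ((τ.le_of_opNorm_le hτ _).trans_eq (one_mul _))

/-- Functions in `L¹` with disjoint supports have additive norms. -/
theorem norm_add_eq_of_disjoint_support {α : Type*} [MeasurableSpace α] (μ : Measure α)
    (A : Set α) (f g : Lp ℝ 1 μ)
    (hf : ∀ᵐ x ∂μ, x ∈ A → f x = 0) (hg : ∀ᵐ x ∂μ, x ∉ A → g x = 0) :
    ‖f + g‖ = ‖f‖ + ‖g‖ := by
  rw [L1.norm_eq_integral_norm, L1.norm_eq_integral_norm, L1.norm_eq_integral_norm,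
    ← integral_add (L1.integrable_coeFn f).norm (L1.integrable_coeFn g).norm]
  refine integral_congr_ae ?_
  filter_upwards [hf, hg, Lp.coeFn_add f g] with x h1 h2 h3
  rw [h3, Pi.add_apply]
  by_cases hx : x ∈ A
  · simp [h1 hx]
  · simp [h2 hx]

section IndicatorL1

variable {α : Type*} [MeasurableSpace α] (μ : Measure α) [IsFiniteMeasure μ]

/-- The indicator function of a measurable set as an element of `L¹` of a finite measure. -/
noncomputable def indicatorL1 {A : Set α} (hA : MeasurableSet A) : Lp ℝ 1 μ :=
  indicatorConstLp 1 hA (measure_ne_top μ A) 1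

theorem norm_indicatorL1 {A : Set α} (hA : MeasurableSet A) :
    ‖indicatorL1 μ hA‖ = μ.real A := by
  simp [indicatorL1, norm_indicatorConstLp]

theorem indicatorL1_eq_add {A B C : Set α} (hA : MeasurableSet A) (hB : MeasurableSet B)
    (hC : MeasurableSet C) (hd : Disjoint B C) (h : A = B ∪ C) :
    indicatorL1 μ hA = indicatorL1 μ hB + indicatorL1 μ hC := by
  subst h
  exact indicatorConstLp_disjoint_union hB hC _ _ hd 1

theorem indicatorL1_eq_zero_of_notMem {A : Set α} (hA : MeasurableSet A) :
    ∀ᵐ x ∂μ, x ∉ A → indicatorL1 μ hA x = 0 :=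
  indicatorConstLp_coeFn_notMem

/-- If every measurable set can be halved, then every measurable set `A` can be halved so that the
sum of the squared differences of finitely many functionals on the two halves is small. -/
theorem exists_half_sum_sq_le
    (hhalf : ∀ A, MeasurableSet A → ∃ B ⊆ A, MeasurableSet B ∧ μ.real B = μ.real A / 2)
    {ι : Type*} (Λ : Finset ι) (ψ : ι → Lp ℝ 1 μ →L[ℝ] ℝ) {C : ℝ}
    (hC : ∀ f, ∑ i ∈ Λ, ψ i f ^ 2 ≤ C * ‖f‖ ^ 2) (k : ℕ) :
    ∀ A (hA : MeasurableSet A), ∃ B, ∃ hB : MeasurableSet B, B ⊆ A ∧ μ.real B = μ.real A / 2 ∧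
      ∑ i ∈ Λ, ψ i ((2 : ℝ) • indicatorL1 μ hB - indicatorL1 μ hA) ^ 2
        ≤ C * μ.real A ^ 2 / 2 ^ k := by
  induction k with
  | zero =>
    intro A hA
    obtain ⟨B, hBA, hB, hBh⟩ := hhalf A hA
    refine ⟨B, hB, hBA, hBh, (hC _).trans ?_⟩
    have hd := measureReal_sdiff (μ := μ) hBA hB
    have h1 : (2 : ℝ) • indicatorL1 μ hB - indicatorL1 μ hA
        = indicatorL1 μ hB + -indicatorL1 μ (hA.diff hB) := by
      rw [indicatorL1_eq_add μ hA hB (hA.diff hB) disjoint_sdiff_right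
        (union_sdiff_cancel hBA).symm, two_smul]
      abel
    have h2 : ‖(2 : ℝ) • indicatorL1 μ hB - indicatorL1 μ hA‖ = μ.real A := by
      rw [h1, add_comm, norm_add_eq_of_disjoint_support μ B, norm_neg, norm_indicatorL1,
        norm_indicatorL1, hd]
      · ring
      · filter_upwards [indicatorL1_eq_zero_of_notMem μ (hA.diff hB),
          Lp.coeFn_neg (indicatorL1 μ (hA.diff hB))] with x hx hx' hxB
        rw [hx', Pi.neg_apply, hx (fun h => h.2 hxB), neg_zero]
      · exact indicatorL1_eq_zero_of_notMem μ hB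
    rw [h2]
    simp
  | succ k ih =>
    intro A hA
    obtain ⟨A₁, hA₁A, hA₁, hA₁h⟩ := hhalf A hA
    have hA₂ := hA.diff hA₁
    have hA₂h : μ.real (A \ A₁) = μ.real A / 2 := by
      rw [measureReal_sdiff hA₁A hA₁, hA₁h]; ring
    obtain ⟨B₁, hB₁, hB₁A, hB₁h, hs₁⟩ := ih A₁ hA₁
    obtain ⟨B₂, hB₂, hB₂A, hB₂h, hs₂⟩ := ih (A \ A₁) hA₂
    rw [hA₁h] at hB₁h hs₁
    rw [hA₂h] at hB₂h hs₂
    have hAdec := indicatorL1_eq_add μ hA hA₁ hA₂ disjoint_sdiff_right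
        (union_sdiff_cancel hA₁A).symm
    have hB₂' := hA₂.diff hB₂
    have hA₂dec := indicatorL1_eq_add μ hA₂ hB₂ hB₂' disjoint_sdiff_right
        (union_sdiff_cancel hB₂A).symm
    have hd : Disjoint A₁ (A \ A₁) := disjoint_sdiff_right
    have hd₁ : Disjoint B₁ B₂ := hd.mono hB₁A hB₂A
    have hd₂ : Disjoint B₁ ((A \ A₁) \ B₂) := hd.mono hB₁A sdiff_subset
    set w₁ := (2 : ℝ) • indicatorL1 μ hB₁ - indicatorL1 μ hA₁ with hw₁
    set w₂ := (2 : ℝ) • indicatorL1 μ hB₂ - indicatorL1 μ hA₂ with hw₂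
    have hpar : ∑ i ∈ Λ, ψ i (w₁ + w₂) ^ 2 + ∑ i ∈ Λ, ψ i (w₁ - w₂) ^ 2
        = 2 * ∑ i ∈ Λ, ψ i w₁ ^ 2 + 2 * ∑ i ∈ Λ, ψ i w₂ ^ 2 := by
      rw [Finset.mul_sum, Finset.mul_sum, ← Finset.sum_add_distrib, ← Finset.sum_add_distrib]
      refine Finset.sum_congr rfl fun i _ => ?_
      rw [map_add, map_sub (ψ i) w₁ w₂]
      ring
    have hval : C * (μ.real A / 2) ^ 2 / 2 ^ k = C * μ.real A ^ 2 / 2 ^ (k + 1) / 2 := by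
      field_simp
      ring
    rw [hval] at hs₁ hs₂
    rcases le_total (∑ i ∈ Λ, ψ i (w₁ + w₂) ^ 2) (∑ i ∈ Λ, ψ i (w₁ - w₂) ^ 2) with hle | hle
    · refine ⟨B₁ ∪ B₂, hB₁.union hB₂, union_subset (hB₁A.trans hA₁A) (hB₂A.trans sdiff_subset),
        ?_, ?_⟩
      · rw [measureReal_union hd₁ hB₂, hB₁h, hB₂h]; ring
      · have : (2 : ℝ) • indicatorL1 μ (hB₁.union hB₂) - indicatorL1 μ hA = w₁ + w₂ := by
          rw [hw₁, hw₂, indicatorL1_eq_add μ (hB₁.union hB₂) hB₁ hB₂ hd₁ rfl, hAdec]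
          module
        rw [this]
        linarith
    · refine ⟨B₁ ∪ ((A \ A₁) \ B₂), hB₁.union hB₂',
        union_subset (hB₁A.trans hA₁A) (sdiff_subset.trans sdiff_subset), ?_, ?_⟩
      · rw [measureReal_union hd₂ hB₂', measureReal_sdiff hB₂A hB₂, hB₁h, hB₂h, hA₂h]; ring
      · have : (2 : ℝ) • indicatorL1 μ (hB₁.union hB₂') - indicatorL1 μ hA = w₁ - w₂ := by
          rw [hw₁, hw₂, indicatorL1_eq_add μ (hB₁.union hB₂') hB₁ hB₂' hd₂ rfl, hAdec, hA₂dec]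
          module
        rw [this]
        linarith

/-- If every measurable set can be halved, then every measurable set `A` can be halved so that
finitely many functionals are almost equal on the two halves. -/
theorem exists_half_abs_le
    (hhalf : ∀ A, MeasurableSet A → ∃ B ⊆ A, MeasurableSet B ∧ μ.real B = μ.real A / 2)
    {ι : Type*} (Λ : Finset ι) (ψ : ι → Lp ℝ 1 μ →L[ℝ] ℝ) {η : ℝ} (hη : 0 < η)
    {A : Set α} (hA : MeasurableSet A) :
    ∃ B, ∃ hB : MeasurableSet B, B ⊆ A ∧ μ.real B = μ.real A / 2 ∧
      ∀ i ∈ Λ, |ψ i ((2 : ℝ) • indicatorL1 μ hB - indicatorL1 μ hA)| ≤ η := by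
  have hC : ∀ f, ∑ i ∈ Λ, ψ i f ^ 2 ≤ (∑ i ∈ Λ, ‖ψ i‖ ^ 2) * ‖f‖ ^ 2 := by
    intro f
    rw [Finset.sum_mul]
    refine Finset.sum_le_sum fun i _ => ?_
    rw [← mul_pow, ← sq_abs]
    exact pow_le_pow_left₀ (abs_nonneg _) ((ψ i).le_opNorm f) 2
  obtain ⟨k, hk⟩ := pow_unbounded_of_one_lt
    ((∑ i ∈ Λ, ‖ψ i‖ ^ 2) * μ.real A ^ 2 / η ^ 2) (one_lt_two (α := ℝ))
  obtain ⟨B, hB, hBA, hBh, hs⟩ := exists_half_sum_sq_le μ hhalf Λ ψ hC k A hA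
  refine ⟨B, hB, hBA, hBh, fun i hi => abs_le_of_sq_le_sq ?_ hη.le⟩
  refine (Finset.single_le_sum (f := fun i => ψ i
    ((2 : ℝ) • indicatorL1 μ hB - indicatorL1 μ hA) ^ 2) (fun i _ => sq_nonneg _) hi).trans
    (hs.trans ?_)
  rw [div_lt_iff₀ (by positivity)] at hk
  rw [div_le_iff₀ (by positivity)]
  linarith

end IndicatorL1

namespace IsUnconditionalSchauderBasis

variable {F : Type*} [NormedAddCommGroup F] [NormedSpace ℝ F] {e : ℕ → F} {coef : ℕ → F →L[ℝ] ℝ}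

/-- The projections associated with an unconditional basis are uniformly bounded. -/
theorem exists_norm_sum_le [CompleteSpace F] (h : IsUnconditionalSchauderBasis F e coef) :
    ∃ K, 0 ≤ K ∧ ∀ (B : Finset ℕ) (y : F), ‖∑ i ∈ B, coef i y • e i‖ ≤ K * ‖y‖ := by
  let P (B : Finset ℕ) : F →L[ℝ] F := ∑ i ∈ B, (coef i).smulRight (e i)
  have hP (B y) : P B y = ∑ i ∈ B, coef i y • e i := by simp [P]
  obtain ⟨K, hK⟩ := banach_steinhaus (g := P) (fun y => by
    obtain ⟨s, hs⟩ := summable_iff_vanishing_norm.1 (h.2 y).summable 1 one_pos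
    refine ⟨∑ i ∈ s, ‖coef i y • e i‖ + 1, fun B => ?_⟩
    rw [hP, ← Finset.sum_inter_add_sum_sdiff B s]
    refine (norm_add_le _ _).trans (add_le_add ((norm_sum_le _ _).trans ?_)
      (hs _ Finset.sdiff_disjoint).le)
    exact Finset.sum_le_sum_of_subset_of_nonneg Finset.inter_subset_right
      fun _ _ _ => norm_nonneg _)
  exact ⟨K, (norm_nonneg _).trans (hK ∅), fun B y => hP B y ▸ (P B).le_of_opNorm_le (hK B) y⟩

/-- Tails of basis expansions are small. -/
theorem exists_superset_norm_sum_le [CompleteSpace F] (h : IsUnconditionalSchauderBasis F e coef)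
    (Λ : Finset ℕ) (y : F) {ε : ℝ} (hε : 0 < ε) :
    ∃ Λ', Λ ⊆ Λ' ∧ (∀ C, Disjoint C Λ' → ‖∑ i ∈ C, coef i y • e i‖ ≤ ε) ∧
      ‖∑ i ∈ Λ', coef i y • e i - y‖ ≤ ε := by
  obtain ⟨s, hs⟩ := summable_iff_vanishing_norm.1 (h.2 y).summable ε hε
  obtain ⟨t, ht⟩ := Metric.tendsto_atTop.1 (h.2 y) ε hε
  refine ⟨Λ ∪ s ∪ t, Finset.subset_union_left.trans Finset.subset_union_left,
    fun C hC => (hs C (hC.mono_right ?_)).le, ?_⟩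
  · exact Finset.subset_union_right.trans Finset.subset_union_left
  · rw [← dist_eq_norm]
    exact (ht _ Finset.subset_union_right).le

/-- The space `L¹` of a finite measure for which all measurable sets can be halved does not embed
into a space with an unconditional basis. -/
theorem not_antilipschitz_of_half [CompleteSpace F] (h : IsUnconditionalSchauderBasis F e coef)
    {α : Type*} [MeasurableSpace α] (μ : Measure α) [IsProbabilityMeasure μ]
    (hhalf : ∀ A, MeasurableSet A → ∃ B ⊆ A, MeasurableSet B ∧ μ.real B = μ.real A / 2)
    (T : Lp ℝ 1 μ →L[ℝ] F) {c : ℝ} (hc : 0 < c) : ¬ ∀ g, c * ‖g‖ ≤ ‖T g‖ := by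
  intro hT
  obtain ⟨K, hK0, hK⟩ := h.exists_norm_sum_le
  set ε := c / 24 with hε_def
  have hε : 0 < ε := by positivity
  have key (n : ℕ) : ∃ (A : Set α) (hA : MeasurableSet A) (s r : ℝ) (G : Lp ℝ 1 μ)
      (Λ B : Finset ℕ), s * μ.real A = 1 ∧ 0 < s ∧ (∀ᵐ x ∂μ, x ∈ A → G x = 0) ∧ n / 4 ≤ ‖G‖ ∧
      B ⊆ Λ ∧ ∀ C, Disjoint C Λ → ‖∑ i ∈ B ∪ C, coef i (T (s • indicatorL1 μ hA)) • e i
        - T (G + r • indicatorL1 μ hA)‖ ≤ 3 * (n + 1) * ε := by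
    induction n with
    | zero =>
      obtain ⟨Λ, -, hΛ, -⟩ := h.exists_superset_norm_sum_le ∅
        (T ((1 : ℝ) • indicatorL1 μ MeasurableSet.univ)) hε
      refine ⟨univ, MeasurableSet.univ, 1, 0, 0, Λ, ∅, by simp, one_pos, ?_, by simp, by simp,
        fun C hC => ?_⟩
      · filter_upwards [Lp.coeFn_zero ℝ 1 μ] with x hx _
        rw [hx, Pi.zero_apply]
      · have := hΛ C hC
        simp only [Finset.empty_union, zero_smul, add_zero, map_zero, sub_zero]
        refine this.trans ?_
        push_cast
        linarith
    | succ n ih =>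
      obtain ⟨A, hA, s, r, G, Λ, B, hsA, hs, hGA, hGn, hBΛ, hclose⟩ := ih
      set M := ∑ i ∈ Λ, ‖e i‖ with hM
      have hM0 : 0 ≤ M := Finset.sum_nonneg fun _ _ => norm_nonneg _
      obtain ⟨A', hA', hA'A, hA'h, hsmall⟩ := exists_half_abs_le μ hhalf Λ
        (fun i => (coef i).comp T) (η := ε / (s * (M + 1))) (by positivity) hA
      set x : Lp ℝ 1 μ := s • ((2 : ℝ) • indicatorL1 μ hA' - indicatorL1 μ hA) with hx
      have hxsmall : ∀ D ⊆ Λ, ‖∑ i ∈ D, coef i (T x) • e i‖ ≤ ε := by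
        intro D hD
        calc ‖∑ i ∈ D, coef i (T x) • e i‖ ≤ ∑ i ∈ D, ‖coef i (T x) • e i‖ := norm_sum_le _ _
          _ ≤ ∑ i ∈ Λ, ‖coef i (T x) • e i‖ :=
            Finset.sum_le_sum_of_subset_of_nonneg hD fun _ _ _ => norm_nonneg _
          _ ≤ ∑ i ∈ Λ, ε / (M + 1) * ‖e i‖ := by
            refine Finset.sum_le_sum fun i hi => ?_
            rw [norm_smul]
            refine mul_le_mul_of_nonneg_right ?_ (norm_nonneg _)
            rw [hx, map_smul, map_smul, norm_smul, Real.norm_of_nonneg hs.le, Real.norm_eq_abs]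
            refine (mul_le_mul_of_nonneg_left (hsmall i hi) hs.le).trans_eq ?_
            field_simp
          _ = ε * (M / (M + 1)) := by rw [← Finset.mul_sum, ← hM]; ring
          _ ≤ ε := mul_le_of_le_one_right hε.le (div_le_one_of_le₀ (by linarith) (by linarith))
      obtain ⟨Λ', hΛΛ', hΛ'C, hΛ'x⟩ := h.exists_superset_norm_sum_le Λ (T x) hε
      have hA'' := hA.diff hA'
      have hA''h : μ.real (A \ A') = μ.real A / 2 := by
        rw [measureReal_sdiff hA'A hA', hA'h]; ring
      have hAdec := indicatorL1_eq_add μ hA hA' hA'' disjoint_sdiff_right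
        (union_sdiff_cancel hA'A).symm
      have hS : (2 * s) • indicatorL1 μ hA' = s • indicatorL1 μ hA + x := by
        rw [hx]; module
      have step (θ : ℝ) (B' : Finset ℕ) (hθ : s / 2 ≤ |r - θ * s|) (hB' : B' ⊆ Λ')
          (hclose' : ∀ C, Disjoint C Λ' →
            ‖∑ i ∈ B' ∪ C, coef i (T (s • indicatorL1 μ hA + x)) • e i
              - T (G + r • indicatorL1 μ hA + θ • x)‖ ≤ 3 * ((n + 1 : ℕ) + 1) * ε) :
          ∃ (A : Set α) (hA : MeasurableSet A) (s r : ℝ) (G : Lp ℝ 1 μ)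
            (Λ B : Finset ℕ), s * μ.real A = 1 ∧ 0 < s ∧ (∀ᵐ x ∂μ, x ∈ A → G x = 0) ∧
            (n + 1 : ℕ) / 4 ≤ ‖G‖ ∧
            B ⊆ Λ ∧ ∀ C, Disjoint C Λ → ‖∑ i ∈ B ∪ C, coef i (T (s • indicatorL1 μ hA)) • e i
              - T (G + r • indicatorL1 μ hA)‖ ≤ 3 * ((n + 1 : ℕ) + 1) * ε := by
        have hzero : ∀ᵐ y ∂μ, y ∉ A \ A' → ((r - θ * s) • indicatorL1 μ hA'') y = 0 := by
          filter_upwards [indicatorL1_eq_zero_of_notMem μ hA'',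
            Lp.coeFn_smul (r - θ * s) (indicatorL1 μ hA'')] with y hy hy' hyA
          rw [hy', Pi.smul_apply, hy hyA, smul_zero]
        refine ⟨A', hA', 2 * s, r + θ * s, G + (r - θ * s) • indicatorL1 μ hA'', Λ', B',
          by rw [hA'h, ← hsA]; ring, by positivity, ?_, ?_, hB', fun C hC => ?_⟩
        · filter_upwards [hGA, hzero,
            Lp.coeFn_add G ((r - θ * s) • indicatorL1 μ hA'')] with y h1 h2 h3 hyA
          rw [h3, Pi.add_apply, h1 (hA'A hyA), h2 (fun h => h.2 hyA), add_zero]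
        · rw [norm_add_eq_of_disjoint_support μ A G _ hGA, norm_smul, norm_indicatorL1, hA''h,
            Real.norm_eq_abs]
          · have : s / 2 * (μ.real A / 2) ≤ |r - θ * s| * (μ.real A / 2) :=
              mul_le_mul_of_nonneg_right hθ (by positivity)
            push_cast
            linarith
          · filter_upwards [hzero] with y hy hyA
            exact hy fun h => hyA h.1
        · have hR : G + (r - θ * s) • indicatorL1 μ hA'' + (r + θ * s) • indicatorL1 μ hA'
              = G + r • indicatorL1 μ hA + θ • x := by
            rw [hx, hAdec]; module
          rw [hS, hR]
          exact hclose' C hC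
      have hsplit (D : Finset ℕ) : ∑ i ∈ D, coef i (T (s • indicatorL1 μ hA + x)) • e i
          = ∑ i ∈ D, coef i (T (s • indicatorL1 μ hA)) • e i + ∑ i ∈ D, coef i (T x) • e i := by
        simp only [map_add, add_smul, Finset.sum_add_distrib]
      rcases le_or_gt (s / 2) |r| with hr | hr
      · refine step 0 B (by simpa using hr) (hBΛ.trans hΛΛ') fun C hC => ?_
        have hBC : Disjoint B C := (hC.mono_right (hBΛ.trans hΛΛ')).symm
        have h1 := hclose C (hC.mono_right hΛΛ')
        have h2 := hxsmall B hBΛ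
        have h3 := hΛ'C C hC
        rw [hsplit, zero_smul, add_zero, Finset.sum_union hBC (f := fun i => coef i (T x) • e i)]
        rw [add_sub_right_comm]
        refine (norm_add_le_of_le h1 (norm_add_le_of_le h2 h3)).trans ?_
        push_cast
        linarith
      · refine step 1 (B ∪ (Λ' \ Λ)) ?_ (Finset.union_subset (hBΛ.trans hΛΛ')
          Finset.sdiff_subset) fun C hC => ?_
        · rw [one_mul, abs_sub_comm]
          have := (abs_lt.1 hr).2
          exact (by linarith : s / 2 ≤ s - r).trans (le_abs_self _)
        have hC' : Disjoint (Λ' \ Λ ∪ C) Λ :=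
          Finset.disjoint_union_left.2 ⟨Finset.sdiff_disjoint, hC.mono_right hΛΛ'⟩
        have h1 := hclose _ hC'
        have h2 := hxsmall (Λ \ B) Finset.sdiff_subset
        have h3 := hΛ'C C hC
        have hdec : ∑ i ∈ B ∪ (Λ' \ Λ) ∪ C, coef i (T x) • e i
            = ∑ i ∈ Λ', coef i (T x) • e i - ∑ i ∈ Λ \ B, coef i (T x) • e i
              + ∑ i ∈ C, coef i (T x) • e i := by
          rw [Finset.sum_union]
          · congr 1
            rw [eq_sub_iff_add_eq, ← Finset.sum_union]
            · congr 1
              ext i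
              have := @hBΛ i
              have := @hΛΛ' i
              simp only [Finset.mem_union, Finset.mem_sdiff]
              tauto
            · rw [Finset.disjoint_left]
              intro i
              simp only [Finset.mem_union, Finset.mem_sdiff]
              tauto
          · exact (hC.mono_right (Finset.union_subset (hBΛ.trans hΛΛ') Finset.sdiff_subset)).symm
        rw [hsplit, hdec, one_smul, map_add, Finset.union_assoc]
        refine le_trans (le_of_eq (congrArg norm ?_)) ((norm_add_le_of_le h1
          (norm_add_le_of_le (norm_sub_le_of_le hΛ'x h2) h3)).trans ?_)
        · abel
        · push_cast
          linarith
  obtain ⟨n, hn⟩ := exists_nat_gt ((K * ‖T‖ + c / 8) * (8 / c))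
  obtain ⟨A, hA, s, r, G, Λ, B, hsA, hs, hGA, hGn, -, hclose⟩ := key n
  have h1 := hclose ∅ (Finset.disjoint_empty_left _)
  have h2 := hK (B ∪ ∅) (T (s • indicatorL1 μ hA))
  have h3 : ‖T (s • indicatorL1 μ hA)‖ ≤ ‖T‖ := by
    refine (T.le_opNorm _).trans_eq ?_
    rw [norm_smul, norm_indicatorL1, Real.norm_of_nonneg hs.le, hsA, mul_one]
  have h4 : ‖G‖ ≤ ‖G + r • indicatorL1 μ hA‖ := by
    rw [norm_add_eq_of_disjoint_support μ A G _ hGA]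
    · exact le_add_of_nonneg_right (norm_nonneg _)
    · filter_upwards [indicatorL1_eq_zero_of_notMem μ hA,
        Lp.coeFn_smul r (indicatorL1 μ hA)] with y hy hy' hyA
      rw [hy', Pi.smul_apply, hy hyA, smul_zero]
  have h5 := hT (G + r • indicatorL1 μ hA)
  have h6 := norm_le_norm_add_norm_sub (∑ i ∈ B ∪ ∅, coef i (T (s • indicatorL1 μ hA)) • e i)
    (T (G + r • indicatorL1 μ hA))
  have h7 := mul_le_mul_of_nonneg_left h3 hK0
  have h8 := mul_le_mul_of_nonneg_left (hGn.trans h4) hc.le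
  have h9 : (K * ‖T‖ + c / 8) * 8 < n * c := by
    rwa [mul_div_assoc', div_lt_iff₀ hc] at hn
  rw [hε_def] at h1
  linarith

end IsUnconditionalSchauderBasis

end

/-- if a pointed metric space `M` contains an isometric copy of a segment
`[0, δ]`, `δ > 0`, then its Lipschitz-free space `F` (axiomatized as a Banach space with
an isometric Dirac map `dm` of dense span, every base-point-vanishing Lipschitz function
extending to a functional of norm bounded by its Lipschitz constant) contains a subspace
isomorphic to `L₁([0,1])`; consequently `F` has no unconditional Schauder basis. -/
theorem segment_implies_no_unconditional_basis
    {M : Type*} [MetricSpace M] (z : M)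
    {F : Type*} [NormedAddCommGroup F] [NormedSpace ℝ F] [CompleteSpace F]
    (dm : M → F) (hdm0 : dm z = 0)
    (hiso : ∀ x y : M, ‖dm x - dm y‖ = dist x y)
    (hspan : Dense (↑(Submodule.span ℝ (Set.range dm)) : Set F))
    (hext : ∀ (g : M → ℝ) (K : ℝ≥0), LipschitzWith K g → g z = 0 →
      ∃ T : F →L[ℝ] ℝ, ‖T‖ ≤ K ∧ ∀ x : M, T (dm x) = g x)
    (δ : ℝ) (hδ : 0 < δ) (γ : ℝ → M)
    (hγ : ∀ s ∈ Set.Icc (0 : ℝ) δ, ∀ t ∈ Set.Icc (0 : ℝ) δ,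
      dist (γ s) (γ t) = |s - t|) :
    (∃ T : MeasureTheory.Lp ℝ 1
        (MeasureTheory.volume : MeasureTheory.Measure (Set.Icc (0 : ℝ) 1)) →L[ℝ] F,
      ∃ c : ℝ, 0 < c ∧ ∀ g, c * ‖g‖ ≤ ‖T g‖) ∧
    ¬∃ (e : ℕ → F) (coef : ℕ → F →L[ℝ] ℝ), IsUnconditionalSchauderBasis F e coef := by
  have hmem (t : ℝ) (ht : t ∈ Set.Icc (0 : ℝ) 1) : δ * t ∈ Set.Icc (0 : ℝ) δ :=
    ⟨mul_nonneg hδ.le ht.1, mul_le_of_le_one_right hδ.le ht.2⟩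
  have hinj : Set.InjOn γ (Set.Icc 0 δ) := fun s hs t ht hst => by
    rw [← sub_eq_zero, ← abs_eq_zero, ← hγ s hs t ht, hst, dist_self]
  obtain ⟨T, hT⟩ := exists_clm_L1_unitInterval_of_curve (fun t => dm (γ (δ * t))) hδ
    (fun u hu v hv => by
      rw [hiso, hγ _ (hmem v hv) _ (hmem u hu), ← mul_sub, abs_mul, abs_of_pos hδ])
    (fun Φ hΦ => by
      have hlip : LipschitzOnWith 1 (fun x => δ * Φ (Function.invFunOn γ (Set.Icc 0 δ) x / δ))
          (γ '' Set.Icc 0 δ) := by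
        refine LipschitzOnWith.of_dist_le_mul ?_
        rintro _ ⟨s, hs, rfl⟩ _ ⟨t, ht, rfl⟩
        rw [hinj.leftInvOn_invFunOn hs, hinj.leftInvOn_invFunOn ht, hγ s hs t ht, Real.dist_eq,
          ← mul_sub, abs_mul, abs_of_pos hδ, NNReal.coe_one, one_mul]
        have := mul_le_mul_of_nonneg_left (hΦ.dist_le_mul (s / δ) (t / δ)) hδ.le
        rwa [NNReal.coe_one, one_mul, Real.dist_eq, Real.dist_eq, ← sub_div, abs_div,
          abs_of_pos hδ, mul_div_cancel₀ _ hδ.ne'] at this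
      obtain ⟨G, hG, hGeq⟩ := hlip.extend_real
      obtain ⟨τ, hτ, hτG⟩ := hext (fun x => G x - G z) 1
        (LipschitzWith.of_dist_le_mul fun x y => by
          simpa only [dist_sub_right] using hG.dist_le_mul x y) (sub_self _)
      refine ⟨τ, hτ, -G z, fun t ht => ?_⟩
      rw [hτG, ← hGeq (Set.mem_image_of_mem γ (hmem t ht))]
      simp only
      rw [hinj.leftInvOn_invFunOn (hmem t ht), mul_div_cancel_left₀ _ hδ.ne', sub_eq_add_neg])
  refine ⟨⟨T, δ, hδ, hT⟩, ?_⟩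
  rintro ⟨e, coef, h⟩
  exact h.not_antilipschitz_of_half _ exists_half_measure_unitInterval T hδ hT
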